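/- Let C and D be two sets of nonnegative integers such that C ∪ D = [0, m] \ {r} with 6 ≤ r ≤ m/2, C ∩ D = ∅, 0 ∈ C, R_C(n) = R_D(n) for every nonnegative integer n, and suppose r = 2^{l−1} with l ≥ 2 and m ≥ 3·2^{l−1}. Then C ∩ [0, 3·2^{l−1}] = A_{l−1} ∪ (2^{l−1} + 1 + B_{l−1}) ∪ (2^l + 1 + B_{l−1}) and D ∩ [0, 3·2^{l−1}] = B_{l−1} ∪ (2^{l−1} + 1 + A_{l−1}) ∪ (2^l + 1 + A_{l−1}). -/

import Mathlib

/-- `R S n` is the number of pairs `(s₁, s₂)` with `s₁, s₂ ∈ S`, `s₁ < s₂` and `s₁ + s₂ = n`. -/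
noncomputable def R (S : Set ℕ) (n : ℕ) : ℕ :=
  Set.ncard {p : ℕ × ℕ | p.1 ∈ S ∧ p.2 ∈ S ∧ p.1 < p.2 ∧ p.1 + p.2 = n}

/-- `A` is the set of nonnegative integers with an even number of binary digits `1`. -/
def A : Set ℕ := {n | Even ((Nat.digits 2 n).count 1)}

/-- `B = ℕ \ A`. -/
def B : Set ℕ := Set.univ \ A

/-- `A_l = A ∩ [0, 2^l - 1]`. -/
def Aset (l : ℕ) : Set ℕ := A ∩ Set.Icc 0 (2 ^ l - 1)

/-- `B_l = B ∩ [0, 2^l - 1]`. -/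
def Bset (l : ℕ) : Set ℕ := B ∩ Set.Icc 0 (2 ^ l - 1)

/-- `t + S = {t + s : s ∈ S}`. -/
def shift (t : ℕ) (S : Set ℕ) : Set ℕ := (fun s => t + s) '' S

open Finset in
lemma R_eq_card (S : Set ℕ) [DecidablePred (· ∈ S)] (n : ℕ) :
    R S n = #{p ∈ antidiagonal n | p.1 < p.2 ∧ p.1 ∈ S ∧ p.2 ∈ S} := by
  rw [R, ← Set.ncard_coe_finset]
  congr 1
  ext p
  simp only [Set.mem_ofPred_eq, coe_filter, HasAntidiagonal.mem_antidiagonal]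
  tauto

open Finset in
lemma sum_antidiagonal_indicator_mul (S : Set ℕ) [DecidablePred (· ∈ S)] (n : ℕ) :
    ∑ p ∈ antidiagonal n, (if p.1 ∈ S then (1 : ℤ) else 0) * (if p.2 ∈ S then 1 else 0) =
      2 * R S n + if Even n then (if n / 2 ∈ S then 1 else 0) else 0 := by
  set F : ℕ × ℕ → ℤ := fun p => (if p.1 ∈ S then (1 : ℤ) else 0) * (if p.2 ∈ S then 1 else 0)
    with hF
  have hlt : ∑ p ∈ antidiagonal n, (if p.1 < p.2 then F p else 0) = R S n := by
    rw [R_eq_card, card_filter]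
    push_cast
    refine sum_congr rfl fun p _ => ?_
    simp only [hF]
    split_ifs <;> simp_all
  have hgt : ∑ p ∈ antidiagonal n, (if p.2 < p.1 then F p else 0) = R S n := by
    rw [← hlt, ← Finset.Nat.sum_antidiagonal_swap]
    refine sum_congr rfl fun p _ => ?_
    simp only [hF, Prod.fst_swap, Prod.snd_swap, mul_comm]
  have heq : ∑ p ∈ antidiagonal n, (if p.1 = p.2 then F p else 0) =
      if Even n then (if n / 2 ∈ S then 1 else 0) else 0 := by
    split_ifs with hn hS
    · obtain ⟨k, rfl⟩ := hn
      have hk : (k + k) / 2 = k := by omega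
      rw [hk] at hS
      rw [sum_eq_single (k, k)]
      · simp [hF, hS]
      · rintro ⟨a, b⟩ hab hne
        rw [HasAntidiagonal.mem_antidiagonal] at hab
        rw [if_neg]
        intro h
        exact hne (by simp only [Prod.mk.injEq]; dsimp only at h hab; omega)
      · simp
    · refine sum_eq_zero fun p hp => ?_
      rw [HasAntidiagonal.mem_antidiagonal] at hp
      split_ifs with h
      · have : p.1 = n / 2 := by omega
        simp [hF, this, hS]
      · rfl
    · refine sum_eq_zero fun p hp => if_neg fun h => hn ⟨p.1, ?_⟩
      rw [HasAntidiagonal.mem_antidiagonal] at hp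
      omega
  rw [two_mul, ← heq]
  nth_rewrite 1 [← hlt]
  rw [← hgt, ← sum_add_distrib, ← sum_add_distrib]
  refine sum_congr rfl fun p _ => ?_
  rcases lt_trichotomy p.1 p.2 with h | h | h
  · simp [h, h.ne, h.not_gt]
  · simp [h]
  · simp [h, h.ne', h.not_gt]

open Classical in
/-- The difference of the indicator functions of `C` and `D`. -/
noncomputable def signDiff (C D : Set ℕ) (n : ℕ) : ℤ :=
  (if n ∈ C then 1 else 0) - (if n ∈ D then 1 else 0)

lemma mem_left_iff_signDiff {C D : Set ℕ} (hdisj : C ∩ D = ∅) {x : ℕ} :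
    x ∈ C ↔ signDiff C D x = 1 := by
  have hx : ¬ (x ∈ C ∧ x ∈ D) := Set.eq_empty_iff_forall_notMem.1 hdisj x
  by_cases hc : x ∈ C <;> by_cases hd : x ∈ D <;> simp_all [signDiff]

lemma mem_right_iff_signDiff {C D : Set ℕ} (hdisj : C ∩ D = ∅) {x : ℕ} :
    x ∈ D ↔ signDiff C D x = -1 := by
  have hx : ¬ (x ∈ C ∧ x ∈ D) := Set.eq_empty_iff_forall_notMem.1 hdisj x
  by_cases hc : x ∈ C <;> by_cases hd : x ∈ D <;> simp_all [signDiff]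

open Finset in
open Classical in
lemma sum_signDiff_mul (C D : Set ℕ) (hR : ∀ n, R C n = R D n) (n : ℕ) :
    ∑ p ∈ antidiagonal n, signDiff C D p.1 *
        ((if p.2 ∈ C then 1 else 0) + (if p.2 ∈ D then 1 else 0)) =
      if Even n then signDiff C D (n / 2) else 0 := by
  have hC := sum_antidiagonal_indicator_mul C n
  have hD := sum_antidiagonal_indicator_mul D n
  have hswap := Finset.Nat.sum_antidiagonal_swap (n := n)
    (f := fun p => (if p.1 ∈ C then (1 : ℤ) else 0) * (if p.2 ∈ D then 1 else 0))
  simp only [Prod.fst_swap, Prod.snd_swap] at hswap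
  have hexp : ∑ p ∈ antidiagonal n, signDiff C D p.1 *
        ((if p.2 ∈ C then 1 else 0) + (if p.2 ∈ D then 1 else 0)) =
      ∑ p ∈ antidiagonal n, (if p.1 ∈ C then (1 : ℤ) else 0) * (if p.2 ∈ C then 1 else 0) -
      ∑ p ∈ antidiagonal n, (if p.1 ∈ D then (1 : ℤ) else 0) * (if p.2 ∈ D then 1 else 0) +
      (∑ p ∈ antidiagonal n, (if p.1 ∈ C then (1 : ℤ) else 0) * (if p.2 ∈ D then 1 else 0) -
      ∑ p ∈ antidiagonal n, (if p.2 ∈ C then (1 : ℤ) else 0) * (if p.1 ∈ D then 1 else 0)) := by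
    rw [← sum_sub_distrib, ← sum_sub_distrib, ← sum_add_distrib]
    refine sum_congr rfl fun p _ => ?_
    rw [signDiff]
    ring
  rw [hexp, hswap, hC, hD, hR n]
  by_cases hn : Even n
  · simp only [if_pos hn, signDiff]
    ring
  · simp only [if_neg hn]
    ring

open Finset in
lemma sum_range_signDiff {m r : ℕ} {C D : Set ℕ} (hCD : C ∪ D = Set.Icc 0 m \ {r})
    (hdisj : C ∩ D = ∅) (hR : ∀ n, R C n = R D n) {n : ℕ} (hn : n ≤ m) :
    ∑ i ∈ range (n + 1), signDiff C D i =
      (if r ≤ n then signDiff C D (n - r) else 0) +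
        if Even n then signDiff C D (n / 2) else 0 := by
  classical
  rw [← sum_signDiff_mul C D hR n, Nat.sum_antidiagonal_eq_sum_range_succ_mk]
  have hind : ∀ j ≤ m, ((if j ∈ C then (1 : ℤ) else 0) + (if j ∈ D then 1 else 0)) =
      1 - if j = r then 1 else 0 := by
    intro j hj
    have h1 : j ∈ C ∨ j ∈ D ↔ j ≠ r := by
      have := Set.ext_iff.1 hCD j
      simpa [hj] using this
    have h2 : ¬ (j ∈ C ∧ j ∈ D) := fun h => by
      have : j ∈ C ∩ D := h
      simp [hdisj] at this
    by_cases hc : j ∈ C <;> by_cases hd : j ∈ D <;> by_cases hjr : j = r <;>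
      simp only [hc, hd, hjr, if_true, if_false] <;> simp_all
  have hterm : ∀ i ∈ range (n + 1), signDiff C D i *
      ((if n - i ∈ C then (1 : ℤ) else 0) + (if n - i ∈ D then 1 else 0)) =
      signDiff C D i - if n - i = r then signDiff C D i else 0 := by
    intro i _
    rw [hind (n - i) (by omega)]
    split_ifs <;> ring
  rw [sum_congr rfl hterm, sum_sub_distrib]
  have hsingle : ∑ i ∈ range (n + 1), (if n - i = r then signDiff C D i else 0) =
      if r ≤ n then signDiff C D (n - r) else 0 := by
    split_ifs with h
    · rw [sum_eq_single (n - r)]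
      · rw [if_pos (by omega)]
      · intro i hi hne
        rw [mem_range] at hi
        exact if_neg (by omega)
      · simp
    · exact sum_eq_zero fun i _ => if_neg (by omega)
  rw [hsingle]
  ring

lemma signDiff_succ {m r : ℕ} {C D : Set ℕ} (hCD : C ∪ D = Set.Icc 0 m \ {r})
    (hdisj : C ∩ D = ∅) (hR : ∀ n, R C n = R D n) {n : ℕ} (hn : n + 1 ≤ m) :
    signDiff C D (n + 1) =
      (if r ≤ n + 1 then signDiff C D (n + 1 - r) else 0) -
        (if r ≤ n then signDiff C D (n - r) else 0) +
        if Even (n + 1) then signDiff C D ((n + 1) / 2) else -signDiff C D ((n + 1) / 2) := by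
  have h1 := sum_range_signDiff hCD hdisj hR hn
  have h0 := sum_range_signDiff hCD hdisj hR (n := n) (by omega)
  rw [Finset.sum_range_succ, h0] at h1
  by_cases he : Even n
  · have ho : ¬ Even (n + 1) := by simpa [Nat.even_add_one] using he
    rw [if_pos he, if_neg ho] at h1
    have : (n + 1) / 2 = n / 2 := by obtain ⟨k, rfl⟩ := he; omega
    rw [if_neg ho, this]
    linarith
  · have ho : Even (n + 1) := by simpa [Nat.even_add_one] using he
    rw [if_neg he, if_pos ho] at h1
    rw [if_pos ho]
    linarith

open Classical in
/-- The `±1`-valued Thue–Morse sequence. -/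
noncomputable def thueMorse (n : ℕ) : ℤ := if n ∈ A then 1 else -1

lemma thueMorse_zero : thueMorse 0 = 1 := by simp [thueMorse, A]

lemma thueMorse_two_mul (n : ℕ) : thueMorse (2 * n) = thueMorse n := by
  rcases Nat.eq_zero_or_pos n with rfl | hn
  · rfl
  · have h : 2 * n ∈ A ↔ n ∈ A := by
      simp only [A, Set.mem_ofPred_eq]
      rw [Nat.digits_def' (n := 2 * n) (by norm_num) (by omega)]
      simp
    by_cases hA : n ∈ A <;> simp [thueMorse, h, hA]

lemma thueMorse_two_mul_add_one (n : ℕ) : thueMorse (2 * n + 1) = -thueMorse n := by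
  have h : 2 * n + 1 ∈ A ↔ n ∉ A := by
    simp only [A, Set.mem_ofPred_eq]
    rw [Nat.digits_def' (n := 2 * n + 1) (by norm_num) (by omega)]
    have h1 : (2 * n + 1) % 2 = 1 := by omega
    have h2 : (2 * n + 1) / 2 = n := by omega
    rw [h1, h2, List.count_cons_self, Nat.even_add_one]
  by_cases hn : n ∈ A <;> simp [thueMorse, h, hn]

lemma thueMorse_two_pow_add (k : ℕ) {j : ℕ} (hj : j < 2 ^ k) :
    thueMorse (2 ^ k + j) = -thueMorse j := by
  induction k generalizing j with
  | zero =>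
    obtain rfl : j = 0 := by simpa using hj
    simpa using thueMorse_two_mul_add_one 0
  | succ k ih =>
    rw [pow_succ] at hj ⊢
    obtain ⟨i, rfl | rfl⟩ := Nat.even_or_odd' j
    · rw [show 2 ^ k * 2 + 2 * i = 2 * (2 ^ k + i) by ring, thueMorse_two_mul, thueMorse_two_mul,
        ih (by omega)]
    · rw [show 2 ^ k * 2 + (2 * i + 1) = 2 * (2 ^ k + i) + 1 by ring, thueMorse_two_mul_add_one,
        thueMorse_two_mul_add_one, ih (by omega)]

section Recursion

variable {k m : ℕ} {C D : Set ℕ}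

lemma signDiff_of_lt (hCD : C ∪ D = Set.Icc 0 m \ {2 ^ (k + 1)}) (hdisj : C ∩ D = ∅)
    (h0 : 0 ∈ C) (hR : ∀ n, R C n = R D n) (hm : 3 * 2 ^ (k + 1) ≤ m) (n : ℕ)
    (hn : n < 2 ^ (k + 1)) : signDiff C D n = thueMorse n := by
  induction n using Nat.strong_induction_on with
  | _ n ih =>
    rcases n with _ | n
    · have hD : 0 ∉ D := fun h => by
        have : 0 ∈ C ∩ D := ⟨h0, h⟩
        simp [hdisj] at this
      simp [signDiff, h0, hD, thueMorse_zero]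
    · rw [signDiff_succ hCD hdisj hR (by omega), if_neg (by omega), if_neg (by omega),
        ih ((n + 1) / 2) (by omega) (by omega)]
      obtain ⟨i, hi | hi⟩ := Nat.even_or_odd' (n + 1)
      · rw [if_pos (by simp [hi]), hi, thueMorse_two_mul, show 2 * i / 2 = i by omega]
        ring
      · rw [if_neg (by simp [hi]), hi, thueMorse_two_mul_add_one,
          show (2 * i + 1) / 2 = i by omega]
        ring

lemma signDiff_two_pow (hCD : C ∪ D = Set.Icc 0 m \ {2 ^ (k + 1)}) :
    signDiff C D (2 ^ (k + 1)) = 0 := by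
  have h := Set.ext_iff.1 hCD (2 ^ (k + 1))
  simp only [Set.mem_union, Set.mem_sdiff, Set.mem_singleton_iff, not_true_eq_false, and_false,
    iff_false, not_or] at h
  simp [signDiff, h]

lemma signDiff_two_pow_add (hCD : C ∪ D = Set.Icc 0 m \ {2 ^ (k + 1)}) (hdisj : C ∩ D = ∅)
    (h0 : 0 ∈ C) (hR : ∀ n, R C n = R D n) (hm : 3 * 2 ^ (k + 1) ≤ m) (j : ℕ)
    (hj : j < 2 ^ (k + 1)) : signDiff C D (2 ^ (k + 1) + 1 + j) = -thueMorse j := by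
  have hlt := signDiff_of_lt hCD hdisj h0 hR hm
  have hr := signDiff_two_pow hCD
  have hN : 2 ^ (k + 1) = 2 * 2 ^ k := by ring
  rw [show 2 ^ (k + 1) + 1 + j = 2 ^ (k + 1) + j + 1 by ring,
    signDiff_succ hCD hdisj hR (by omega), if_pos (by omega), if_pos (by omega),
    show 2 ^ (k + 1) + j + 1 - 2 ^ (k + 1) = j + 1 by omega,
    show 2 ^ (k + 1) + j - 2 ^ (k + 1) = j by omega, hlt j hj]
  rcases Nat.lt_or_ge (j + 1) (2 ^ (k + 1)) with hj1 | hj1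
  · rw [hlt (j + 1) hj1]
    obtain ⟨i, hi | hi⟩ := Nat.even_or_odd' (j + 1)
    · have hn : 2 ^ (k + 1) + j + 1 = 2 * (2 ^ k + i) := by omega
      rw [if_pos (by simp [hn]), hn, Nat.mul_div_cancel_left _ (by norm_num),
        hlt _ (by omega), hi, thueMorse_two_mul, thueMorse_two_pow_add k (by omega)]
      ring
    · have hn : 2 ^ (k + 1) + j + 1 = 2 * (2 ^ k + i) + 1 := by omega
      rw [if_neg (by simp [hn]), hn, show (2 * (2 ^ k + i) + 1) / 2 = 2 ^ k + i by omega,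
        hlt _ (by omega), hi, thueMorse_two_mul_add_one, thueMorse_two_pow_add k (by omega)]
      ring
  · rw [show j + 1 = 2 ^ (k + 1) by omega, hr,
      show (2 ^ (k + 1) + j + 1) / 2 = 2 ^ (k + 1) by omega, hr]
    simp

lemma signDiff_two_mul_two_pow_add (hCD : C ∪ D = Set.Icc 0 m \ {2 ^ (k + 1)})
    (hdisj : C ∩ D = ∅) (h0 : 0 ∈ C) (hR : ∀ n, R C n = R D n) (hm : 3 * 2 ^ (k + 1) ≤ m)
    (j : ℕ) (hj : j < 2 ^ (k + 1)) :
    signDiff C D (2 * 2 ^ (k + 1) + 1 + j) = -thueMorse j := by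
  have hmid := signDiff_two_pow_add hCD hdisj h0 hR hm
  have hr := signDiff_two_pow hCD
  rw [show 2 * 2 ^ (k + 1) + 1 + j = 2 * 2 ^ (k + 1) + j + 1 by ring,
    signDiff_succ hCD hdisj hR (by omega), if_pos (by omega), if_pos (by omega),
    show 2 * 2 ^ (k + 1) + j + 1 - 2 ^ (k + 1) = 2 ^ (k + 1) + 1 + j by omega,
    show 2 * 2 ^ (k + 1) + j - 2 ^ (k + 1) = 2 ^ (k + 1) + j by omega, hmid j hj]
  rcases j with _ | j
  · rw [add_zero, hr, if_neg (by simp),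
      show (2 * 2 ^ (k + 1) + 1) / 2 = 2 ^ (k + 1) by omega, hr]
    ring
  · rw [show 2 ^ (k + 1) + (j + 1) = 2 ^ (k + 1) + 1 + j by ring, hmid j (by omega)]
    obtain ⟨i, rfl | rfl⟩ := Nat.even_or_odd' j
    · have hn : 2 * 2 ^ (k + 1) + (2 * i + 1) + 1 = 2 * (2 ^ (k + 1) + 1 + i) := by ring
      rw [hn, if_pos (by simp), Nat.mul_div_cancel_left _ (by norm_num), hmid i (by omega),
        thueMorse_two_mul]
      ring
    · have hn : 2 * 2 ^ (k + 1) + (2 * i + 1 + 1) + 1 = 2 * (2 ^ (k + 1) + 1 + i) + 1 := by ring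
      rw [hn, if_neg (by simp), show (2 * (2 ^ (k + 1) + 1 + i) + 1) / 2 = 2 ^ (k + 1) + 1 + i
        by omega, hmid i (by omega), thueMorse_two_mul_add_one]
      ring

end Recursion

lemma mem_Aset {k x : ℕ} : x ∈ Aset k ↔ x < 2 ^ k ∧ thueMorse x = 1 := by
  have := Nat.two_pow_pos k
  have h : x ≤ 2 ^ k - 1 ↔ x < 2 ^ k := by omega
  by_cases hx : x ∈ A <;> simp [Aset, thueMorse, hx, h]

lemma mem_Bset {k x : ℕ} : x ∈ Bset k ↔ x < 2 ^ k ∧ thueMorse x = -1 := by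
  have := Nat.two_pow_pos k
  have h : x ≤ 2 ^ k - 1 ↔ x < 2 ^ k := by omega
  by_cases hx : x ∈ A <;> simp [Bset, B, thueMorse, hx, h]

lemma mem_shift {t x : ℕ} {S : Set ℕ} : x ∈ shift t S ↔ t ≤ x ∧ x - t ∈ S := by
  constructor
  · rintro ⟨s, hs, rfl⟩
    simpa using hs
  · rintro ⟨h, hs⟩
    exact ⟨x - t, hs, Nat.add_sub_cancel' h⟩

theorem stmt_18 (m r l : ℕ) (hr6 : 6 ≤ r) (hrm : 2 * r ≤ m) (C D : Set ℕ)
    (hCD : C ∪ D = Set.Icc 0 m \ {r}) (hdisj : C ∩ D = ∅) (h0C : 0 ∈ C)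
    (hR : ∀ n : ℕ, R C n = R D n)
    (hl : 2 ≤ l) (hrl : r = 2 ^ (l - 1)) (hm : 3 * 2 ^ (l - 1) ≤ m) :
    C ∩ Set.Icc 0 (3 * 2 ^ (l - 1)) =
      Aset (l - 1) ∪ shift (2 ^ (l - 1) + 1) (Bset (l - 1)) ∪
        shift (2 ^ l + 1) (Bset (l - 1)) ∧
    D ∩ Set.Icc 0 (3 * 2 ^ (l - 1)) =
      Bset (l - 1) ∪ shift (2 ^ (l - 1) + 1) (Aset (l - 1)) ∪
        shift (2 ^ l + 1) (Aset (l - 1)) := by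
  obtain ⟨k, rfl⟩ : ∃ k, l = k + 2 := ⟨l - 2, by omega⟩
  have hk : k + 2 - 1 = k + 1 := rfl
  rw [hk] at hrl hm ⊢
  subst hrl
  have hlow := signDiff_of_lt hCD hdisj h0C hR hm
  have hr := signDiff_two_pow hCD
  have hmid := signDiff_two_pow_add hCD hdisj h0C hR hm
  have hhigh := signDiff_two_mul_two_pow_add hCD hdisj h0C hR hm
  have hpow : 2 ^ (k + 2) = 2 * 2 ^ (k + 1) := by ring
  have hC := fun x => mem_left_iff_signDiff hdisj (x := x)
  have hD := fun x => mem_right_iff_signDiff hdisj (x := x)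
  rw [hpow]
  constructor <;> ext x
  all_goals
    simp only [Set.mem_inter_iff, Set.mem_Icc, Set.mem_union, mem_shift, mem_Aset, mem_Bset, hC,
      hD]
    clear hpow
    generalize 2 ^ (k + 1) = N at *
    rcases Nat.lt_trichotomy x N with h | rfl | h
    · have := hlow x h
      omega
    · omega
    · rcases Nat.lt_or_ge (2 * N) x with h2 | h2
      · rcases Nat.lt_or_ge (3 * N) x with h3 | h3
        · omega
        · have := hhigh (x - (2 * N + 1)) (by omega)
          rw [Nat.add_sub_cancel' h2] at this
          omega
      · have := hmid (x - (N + 1)) (by omega)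
        rw [Nat.add_sub_cancel' h] at this
        omega
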